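/- Let 𝒟 = {(X_i, B_i): i ∈ I} be a collection of random variable/nonempty event pairs with coherent₁ conditional previsions {P(X_i|B_i): i ∈ I} such that 𝒟 contains all pairs (c, Ω) with c a constant random variable (and P(c|Ω) = c). Let ℱ be any set of random variable/nonempty event pairs containing 𝒟. Then there exists an extended-real-valued function P′ on ℱ that agrees with P on 𝒟 and such that the collection {P′(X|B): (X,B) ∈ ℱ} is coherent₁. -/

import Mathlib

open scoped BigOperators

noncomputable section

/-- The indicator function of an event `B`, as a real-valued random variable. -/
def indicatorRV {Ω : Type*} (B : Set Ω) : Ω → ℝ := B.indicator fun _ => 1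

/-- De Finetti-style coherence₁ for a collection of conditional previsions
`P (X i | B i)`, allowing infinite previsions.  For every finite subcollection,
all real coefficients `α j` (nonnegative where the prevision is `⊤`, nonpositive
where it is `⊥`), and all real prices `c j` that agree with the prevision wherever
it is finite, the resulting acceptable gamble has nonnegative supremum. -/
def Coherent1 {Ω I : Type*} (X : I → Ω → ℝ) (B : I → Set Ω) (P : I → EReal) : Prop :=
  ∀ (n : ℕ) (idx : Fin n → I) (α c : Fin n → ℝ),
    (∀ j, P (idx j) = ⊤ → 0 ≤ α j) →
    (∀ j, P (idx j) = ⊥ → α j ≤ 0) →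
    (∀ j, P (idx j) ≠ ⊤ → P (idx j) ≠ ⊥ → (c j : EReal) = P (idx j)) →
    0 ≤ ⨆ ω, ((∑ j, α j * indicatorRV (B (idx j)) ω * (X (idx j) ω - c j) : ℝ) : EReal)


/-- A convex cone of gambles avoids sure loss if none of its members is bounded above by a
negative constant. -/
def AvoidsSureLoss {Ω : Type*} (K : Submodule NNReal (Ω → ℝ)) : Prop :=
  ∀ g ∈ K, ∀ ε : ℝ, 0 < ε → ∃ ω, -ε < g ω

/-- `IsAcceptable X B p g` says that `g` is a gamble `α B (X - c)` that is acceptable when the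
conditional prevision of `X` given `B` is `p`. -/
def IsAcceptable {Ω : Type*} (X : Ω → ℝ) (B : Set Ω) (p : EReal) (g : Ω → ℝ) : Prop :=
  ∃ α c : ℝ, (p = ⊤ → 0 ≤ α) ∧ (p = ⊥ → α ≤ 0) ∧ (p ≠ ⊤ → p ≠ ⊥ → (c : EReal) = p) ∧
    g = fun ω => α * indicatorRV B ω * (X ω - c)

theorem indicatorRV_nonneg {Ω : Type*} (B : Set Ω) (ω : Ω) : 0 ≤ indicatorRV B ω :=
  Set.indicator_nonneg (fun _ _ => zero_le_one) ω

theorem indicatorRV_le_one {Ω : Type*} (B : Set Ω) (ω : Ω) : indicatorRV B ω ≤ 1 :=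
  Set.indicator_le' (fun _ _ => le_rfl) (fun _ _ => zero_le_one) ω

theorem IsAcceptable.smul {Ω : Type*} {X : Ω → ℝ} {B : Set Ω} {p : EReal} {g : Ω → ℝ}
    (hg : IsAcceptable X B p g) (r : NNReal) : IsAcceptable X B p (r • g) := by
  obtain ⟨α, c, h1, h2, h3, rfl⟩ := hg
  refine ⟨r * α, c, fun h => mul_nonneg r.2 (h1 h),
    fun h => mul_nonpos_of_nonneg_of_nonpos r.2 (h2 h), h3, ?_⟩
  funext ω
  simp only [Pi.smul_apply, NNReal.smul_def, smul_eq_mul]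
  ring

theorem Submodule.mul_mem_of_nonneg {Ω : Type*} (M : Submodule NNReal (Ω → ℝ)) {r : ℝ}
    (hr : 0 ≤ r) {g : Ω → ℝ} (hg : g ∈ M) : (fun ω => r * g ω) ∈ M :=
  M.smul_mem (⟨r, hr⟩ : NNReal) hg

/-- The gambles acceptable under a coherent₁ collection generate a cone avoiding sure loss. -/
theorem Coherent1.avoidsSureLoss_span {Ω I : Type*} {X : I → Ω → ℝ} {B : I → Set Ω}
    {P : I → EReal} (h : Coherent1 X B P) :
    AvoidsSureLoss (Submodule.span NNReal {g | ∃ i, IsAcceptable (X i) (B i) (P i) g}) := by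
  intro g hg ε hε
  rw [← Submodule.mem_toAddSubmonoid, Submodule.span_eq_closure] at hg
  obtain ⟨l, hl, rfl⟩ := AddSubmonoid.exists_list_of_mem_closure hg
  have key : ∀ j : Fin l.length, ∃ i, IsAcceptable (X i) (B i) (P i) (l.get j) := by
    intro j
    obtain ⟨r, -, f, ⟨i, hi⟩, hf⟩ := hl _ (l.get_mem j)
    exact ⟨i, hf ▸ hi.smul r⟩
  choose idx α c h1 h2 h3 h4 using key
  have hsup := h l.length idx α c h1 h2 h3
  have hlt : ((-ε : ℝ) : EReal) < 0 := by exact_mod_cast neg_lt_zero.2 hε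
  obtain ⟨ω, hω⟩ := lt_iSup_iff.1 (hlt.trans_le hsup)
  refine ⟨ω, ?_⟩
  have hsum : l.sum = ∑ j, l.get j := by
    rw [← List.sum_ofFn, List.ofFn_get]
  rw [hsum, Finset.sum_apply]
  simp only [h4]
  exact EReal.coe_lt_coe_iff.1 hω

/-- A collection whose acceptable gambles all lie in a cone avoiding sure loss is coherent₁. -/
theorem AvoidsSureLoss.coherent1 {Ω I : Type*} {K : Submodule NNReal (Ω → ℝ)}
    (hK : AvoidsSureLoss K) {X : I → Ω → ℝ} {B : I → Set Ω} {P : I → EReal}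
    (h : ∀ i g, IsAcceptable (X i) (B i) (P i) g → g ∈ K) : Coherent1 X B P := by
  intro n idx α c h1 h2 h3
  have hmem : (∑ j, fun ω => α j * indicatorRV (B (idx j)) ω * (X (idx j) ω - c j)) ∈ K :=
    Submodule.sum_mem _ fun j _ => h (idx j) _ ⟨α j, c j, h1 j, h2 j, h3 j, rfl⟩
  refine EReal.ge_of_forall_gt_iff_ge.1 fun z hz => ?_
  have hz' : z < 0 := by exact_mod_cast hz
  obtain ⟨ω, hω⟩ := hK _ hmem (-z) (neg_pos.2 hz')
  refine le_trans ?_ (le_iSup _ ω)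
  rw [neg_neg, Finset.sum_apply] at hω
  exact EReal.coe_le_coe_iff.2 hω.le

/-- Every cone avoiding sure loss is contained in a maximal one. -/
theorem AvoidsSureLoss.exists_maximal {Ω : Type*} {K : Submodule NNReal (Ω → ℝ)}
    (hK : AvoidsSureLoss K) : ∃ M, K ≤ M ∧ Maximal AvoidsSureLoss M := by
  refine zorn_le_nonempty₀ {M : Submodule NNReal (Ω → ℝ) | AvoidsSureLoss M} ?_ K hK
  intro C hC hchain N hN
  refine ⟨sSup C, fun g hg ε hε => ?_, fun M hM => le_sSup hM⟩
  obtain ⟨M, hM, hgM⟩ := (Submodule.mem_sSup_of_directed ⟨N, hN⟩ hchain.directedOn).1 hg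
  exact hC hM g hgM ε hε

section Maximal

variable {Ω : Type*} {M : Submodule NNReal (Ω → ℝ)}

theorem exists_sure_loss_of_notMem (hM : Maximal AvoidsSureLoss M) {f : Ω → ℝ} (hf : f ∉ M) :
    ∃ g ∈ M, ∃ r ε : ℝ, 0 < r ∧ 0 < ε ∧ ∀ ω, g ω + r * f ω ≤ -ε := by
  have hnot : ¬ AvoidsSureLoss (M ⊔ Submodule.span NNReal {f}) := fun h =>
    hf (hM.le_of_ge h le_sup_left
      (Submodule.mem_sup_right (Submodule.mem_span_singleton_self f)))
  simp only [AvoidsSureLoss] at hnot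
  push Not at hnot
  obtain ⟨h, hh, ε, hε, hle⟩ := hnot
  obtain ⟨g, hg, k, hk, rfl⟩ := Submodule.mem_sup.1 hh
  obtain ⟨r, rfl⟩ := Submodule.mem_span_singleton.1 hk
  refine ⟨g, hg, r, ε, ?_, hε, hle⟩
  refine lt_of_le_of_ne r.2 fun h0 => ?_
  obtain ⟨ω, hω⟩ := hM.prop g hg ε hε
  have := hle ω
  simp only [Pi.add_apply, Pi.smul_apply, NNReal.smul_def, smul_eq_mul] at this
  change (0 : ℝ) = (r : ℝ) at h0
  rw [← h0] at this
  linarith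

theorem mem_of_forall_add_const_le (hM : Maximal AvoidsSureLoss M) {f : Ω → ℝ}
    (h : ∀ ε : ℝ, 0 < ε → ∃ k ∈ M, ∀ ω, k ω ≤ f ω + ε) : f ∈ M := by
  by_contra hf
  obtain ⟨g, hg, r, ε, hr, hε, hle⟩ := exists_sure_loss_of_notMem hM hf
  obtain ⟨k, hk, hkf⟩ := h (ε / (2 * r)) (by positivity)
  obtain ⟨ω, hω⟩ := hM.prop _ (M.add_mem hg (M.mul_mem_of_nonneg hr.le hk)) (ε / 2) (by positivity)
  simp only [Pi.add_apply] at hω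
  have h1 := mul_le_mul_of_nonneg_left (hkf ω) hr.le
  have h2 : r * (ε / (2 * r)) = ε / 2 := by field_simp
  linarith [hle ω]

theorem mem_of_le (hM : Maximal AvoidsSureLoss M) {f k : Ω → ℝ} (hk : k ∈ M)
    (h : ∀ ω, k ω ≤ f ω) : f ∈ M :=
  mem_of_forall_add_const_le hM fun _ hε => ⟨k, hk, fun ω => by linarith [h ω]⟩

theorem neg_mem_of_notMem (hM : Maximal AvoidsSureLoss M) {f : Ω → ℝ} (hf : f ∉ M) :
    -f ∈ M := by
  by_contra hf'
  obtain ⟨g, hg, r, ε, hr, hε, hle⟩ := exists_sure_loss_of_notMem hM hf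
  obtain ⟨g', hg', r', ε', hr', hε', hle'⟩ := exists_sure_loss_of_notMem hM hf'
  obtain ⟨ω, hω⟩ := hM.prop _
    (M.add_mem (M.mul_mem_of_nonneg hr'.le hg) (M.mul_mem_of_nonneg hr.le hg')) (r' * ε + r * ε')
    (by positivity)
  simp only [Pi.add_apply] at hω
  have h1 := mul_le_mul_of_nonneg_left (hle ω) hr'.le
  have h2 := mul_le_mul_of_nonneg_left (hle' ω) hr.le
  simp only [Pi.neg_apply] at h2
  linarith

/-- The largest price at which buying `X` conditionally on `B` is acceptable for `M`. -/
def conePrevision (M : Submodule NNReal (Ω → ℝ)) (X : Ω → ℝ) (B : Set Ω) : EReal :=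
  ⨆ c ∈ {c : ℝ | (fun ω => indicatorRV B ω * (X ω - c)) ∈ M}, (c : EReal)

theorem buy_mem_of_lt_conePrevision (hM : Maximal AvoidsSureLoss M) {X : Ω → ℝ} {B : Set Ω}
    {c : ℝ} (h : (c : EReal) < conePrevision M X B) :
    (fun ω => indicatorRV B ω * (X ω - c)) ∈ M := by
  simp only [conePrevision, lt_iSup_iff] at h
  obtain ⟨c', hc', hlt⟩ := h
  refine mem_of_le hM hc' fun ω => ?_
  have : c < c' := EReal.coe_lt_coe_iff.1 hlt
  exact mul_le_mul_of_nonneg_left (by linarith) (indicatorRV_nonneg B ω)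

theorem sell_mem_of_conePrevision_lt (hM : Maximal AvoidsSureLoss M) {X : Ω → ℝ} {B : Set Ω}
    {c : ℝ} (h : conePrevision M X B < c) :
    -(fun ω => indicatorRV B ω * (X ω - c)) ∈ M :=
  neg_mem_of_notMem hM fun hc => h.not_ge (le_iSup₂_of_le c hc le_rfl)

theorem IsAcceptable.mem_of_conePrevision (hM : Maximal AvoidsSureLoss M) {X : Ω → ℝ}
    {B : Set Ω} {g : Ω → ℝ} (hg : IsAcceptable X B (conePrevision M X B) g) : g ∈ M := by
  obtain ⟨α, c, h1, h2, h3, rfl⟩ := hg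
  have buy : conePrevision M X B ≠ ⊥ → (fun ω => indicatorRV B ω * (X ω - c)) ∈ M := by
    intro hbot
    by_cases htop : conePrevision M X B = ⊤
    · exact buy_mem_of_lt_conePrevision hM (htop ▸ EReal.coe_lt_top c)
    · refine mem_of_forall_add_const_le hM fun ε hε =>
        ⟨_, buy_mem_of_lt_conePrevision hM (X := X) (B := B) (c := c - ε) ?_, fun ω => ?_⟩
      · rw [← h3 htop hbot]
        exact EReal.coe_lt_coe_iff.2 (by linarith)
      · nlinarith [indicatorRV_le_one B ω]
  have sell : conePrevision M X B ≠ ⊤ → -(fun ω => indicatorRV B ω * (X ω - c)) ∈ M := by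
    intro htop
    by_cases hbot : conePrevision M X B = ⊥
    · exact sell_mem_of_conePrevision_lt hM (hbot ▸ EReal.bot_lt_coe c)
    · refine mem_of_forall_add_const_le hM fun ε hε =>
        ⟨_, sell_mem_of_conePrevision_lt hM (X := X) (B := B) (c := c + ε) ?_, fun ω => ?_⟩
      · rw [← h3 htop hbot]
        exact EReal.coe_lt_coe_iff.2 (by linarith)
      · simp only [Pi.neg_apply]
        nlinarith [indicatorRV_le_one B ω]
  rcases lt_trichotomy α 0 with hα | rfl | hα
  · have := M.mul_mem_of_nonneg (neg_nonneg.2 hα.le) (sell fun h => hα.not_ge (h1 h))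
    convert this using 1
    funext ω
    simp only [Pi.neg_apply]
    ring
  · simp only [zero_mul]
    exact M.zero_mem
  · have := M.mul_mem_of_nonneg hα.le (buy fun h => hα.not_ge (h2 h))
    convert this using 1
    funext ω
    ring

end Maximal

/-- The Fundamental Theorem of Prevision: a coherent₁ collection of conditional
previsions on a set `D` of random variable/nonempty event pairs that contains all
pairs `(c, Ω)` with `c` constant (and assigns them prevision `c`) can be extended to
a coherent₁ collection of conditional previsions on any larger set `F` of random
variable/nonempty event pairs. -/
theorem fundamental_theorem_of_prevision {Ω : Type*} [Nonempty Ω]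
    (D F : Set ((Ω → ℝ) × Set Ω)) (hDF : D ⊆ F)
    (hFne : ∀ p ∈ F, p.2.Nonempty)
    (hDconst : ∀ c : ℝ, ((fun _ => c : Ω → ℝ), (Set.univ : Set Ω)) ∈ D)
    (P : (Ω → ℝ) × Set Ω → EReal)
    (hPconst : ∀ c : ℝ, P ((fun _ => c : Ω → ℝ), (Set.univ : Set Ω)) = (c : EReal))
    (hcoh : Coherent1 (fun d : D => (d : (Ω → ℝ) × Set Ω).1)
      (fun d => (d : (Ω → ℝ) × Set Ω).2) (fun d => P d)) :
    ∃ P' : (Ω → ℝ) × Set Ω → EReal,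
      (∀ d ∈ D, P' d = P d) ∧
      Coherent1 (fun f : F => (f : (Ω → ℝ) × Set Ω).1)
        (fun f => (f : (Ω → ℝ) × Set Ω).2) (fun f => P' f) := by
  classical
  obtain ⟨M, hle, hM⟩ := hcoh.avoidsSureLoss_span.exists_maximal
  refine ⟨fun f => if f ∈ D then P f else conePrevision M f.1 f.2,
    fun d hd => if_pos hd, hM.prop.coherent1 fun f g hg => ?_⟩
  by_cases hf : (f : (Ω → ℝ) × Set Ω) ∈ D
  · simp only [if_pos hf] at hg
    exact hle (Submodule.subset_span ⟨⟨f, hf⟩, hg⟩)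
  · simp only [if_neg hf] at hg
    exact hg.mem_of_conePrevision hM

end
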